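/- arXiv:2108.05282 — 3 statements merged into one kernel-verified Lean document; each statement's English description precedes it below -/
import Mathlib

section
/- For every λ > 1 and every natural number n, one has (1 − 1/λ²)·(−1/λ)^n + ∫_{λ−2}^{λ+2} x^n · √(4 − (x − λ)²)/(2π(λx + 1)) dx = b_{1,n}(λ); that is, the measure consisting of an atom of mass 1 − 1/λ² at −1/λ plus the absolutely continuous part with density x ↦ √(4 − (x − λ)²)/(2π(λx + 1)) on [λ − 2, λ + 2] has n-th moment equal to the λ-weighted Riordan count b_{1,n}(λ). -/
open MeasureTheory

-- A Motzkin path, encoded as a word over `Fin 3`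
-- (`0` = up-step `a`, `1` = down-step `b`, `2` = level-step `c`):
-- every prefix has at least as many up-steps as down-steps, and the full word
-- has equally many up-steps and down-steps.
def IsMotzkin (u : List (Fin 3)) : Prop :=
  (∀ j : ℕ, (u.take j).count 1 ≤ (u.take j).count 0) ∧ u.count 0 = u.count 1

-- A Riordan path: a Motzkin path with no level-step at height `0`.
def IsRiordan (u : List (Fin 3)) : Prop :=
  IsMotzkin u ∧
    ∀ j : Fin u.length, u.get j = 2 → (u.take j).count 1 < (u.take j).count 0

-- `bOne lam n = b_{1,n}(λ) = Σ_{u ∈ 𝓡(n)} λ^{|u|_c}`, the λ-weighted count of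
-- Riordan paths of size `n` (words of length `n` encoded by functions `Fin n → Fin 3`).
open Classical in
noncomputable def bOne (lam : ℝ) (n : ℕ) : ℝ :=
  ∑ f : Fin n → Fin 3,
    if IsRiordan (List.ofFn f) then lam ^ ((List.ofFn f).count 2) else 0

-- `mOne lam n = M_n(λ) = Σ_{u ∈ 𝓜(n)} λ^{|u|_c}`, the λ-weighted count of
-- Motzkin paths of size `n`.
open Classical in
noncomputable def mOne (lam : ℝ) (n : ℕ) : ℝ :=
  ∑ f : Fin n → Fin 3,
    if IsMotzkin (List.ofFn f) then lam ^ ((List.ofFn f).count 2) else 0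

/-- `u` is a suffix of a Riordan path that starts at height `h`. -/
def RiordanFrom (h : ℕ) (u : List (Fin 3)) : Prop :=
  (∀ j : ℕ, (u.take j).count 1 ≤ h + (u.take j).count 0) ∧ h + u.count 0 = u.count 1 ∧
    ∀ j : ℕ, u[j]? = some 2 → (u.take j).count 1 < h + (u.take j).count 0

theorem isRiordan_iff_riordanFrom_zero (u : List (Fin 3)) : IsRiordan u ↔ RiordanFrom 0 u := by
  unfold IsRiordan IsMotzkin RiordanFrom
  simp only [zero_add, and_assoc]
  refine and_congr_right fun _ => and_congr_right fun _ => ⟨fun H j hj => ?_, fun H j hj => ?_⟩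
  · obtain ⟨hlt, hj⟩ := List.getElem?_eq_some_iff.1 hj
    exact H ⟨j, hlt⟩ hj
  · exact H j (List.getElem?_eq_some_iff.2 ⟨j.2, hj⟩)

theorem riordanFrom_nil (h : ℕ) : RiordanFrom h [] ↔ h = 0 := by
  simp [RiordanFrom]

theorem riordanFrom_up (h : ℕ) (u : List (Fin 3)) :
    RiordanFrom h (0 :: u) ↔ RiordanFrom (h + 1) u := by
  unfold RiordanFrom
  rw [← Nat.and_forall_add_one, ← Nat.and_forall_add_one (p := fun j => (0 :: u)[j]? = some 2 → _)]
  simp [add_assoc, add_comm 1]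

theorem not_riordanFrom_zero_down (u : List (Fin 3)) : ¬ RiordanFrom 0 (1 :: u) := by
  intro H
  simpa using H.1 1

theorem riordanFrom_succ_down (h : ℕ) (u : List (Fin 3)) :
    RiordanFrom (h + 1) (1 :: u) ↔ RiordanFrom h u := by
  unfold RiordanFrom
  rw [← Nat.and_forall_add_one, ← Nat.and_forall_add_one (p := fun j => (1 :: u)[j]? = some 2 → _)]
  simp [add_right_comm h 1]

theorem riordanFrom_level (h : ℕ) (u : List (Fin 3)) :
    RiordanFrom h (2 :: u) ↔ 0 < h ∧ RiordanFrom h u := by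
  unfold RiordanFrom
  rw [← Nat.and_forall_add_one, ← Nat.and_forall_add_one (p := fun j => (2 :: u)[j]? = some 2 → _)]
  simp
  tauto

open Classical in
/-- The weighted number of suffixes of length `n`, starting at height `h`, of Riordan paths. -/
noncomputable def riordanSum (lam : ℝ) (n h : ℕ) : ℝ :=
  ∑ f : Fin n → Fin 3,
    if RiordanFrom h (List.ofFn f) then lam ^ ((List.ofFn f).count 2) else 0

open Classical in
theorem bOne_eq_riordanSum (lam : ℝ) (n : ℕ) : bOne lam n = riordanSum lam n 0 := by
  exact Finset.sum_congr rfl fun f _ => if_congr (isRiordan_iff_riordanFrom_zero _) rfl rfl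

theorem riordanSum_zero (lam : ℝ) (h : ℕ) : riordanSum lam 0 h = if h = 0 then 1 else 0 := by
  simp [riordanSum, riordanFrom_nil]

open Classical in
theorem riordanSum_succ (lam : ℝ) (n h : ℕ) :
    riordanSum lam (n + 1) h = riordanSum lam n (h + 1) +
      (∑ f : Fin n → Fin 3,
        if RiordanFrom h (1 :: List.ofFn f) then lam ^ ((List.ofFn f).count 2) else 0) +
      ∑ f : Fin n → Fin 3,
        if RiordanFrom h (2 :: List.ofFn f) then lam ^ ((List.ofFn f).count 2 + 1) else 0 := by
  unfold riordanSum
  rw [← (Fin.consEquiv (fun _ => Fin 3)).sum_comp, Fintype.sum_prod_type, Fin.sum_univ_three]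
  simp [Fin.consEquiv, List.ofFn_succ, riordanFrom_up]

theorem riordanSum_succ_zero (lam : ℝ) (n : ℕ) :
    riordanSum lam (n + 1) 0 = riordanSum lam n 1 := by
  simp [riordanSum_succ, not_riordanFrom_zero_down, riordanFrom_level]

open Classical in
theorem riordanSum_succ_succ (lam : ℝ) (n h : ℕ) :
    riordanSum lam (n + 1) (h + 1) =
      riordanSum lam n (h + 2) + riordanSum lam n h + lam * riordanSum lam n (h + 1) := by
  rw [riordanSum_succ]
  congr 1
  · congr 1
    exact Finset.sum_congr rfl fun f _ => if_congr (riordanFrom_succ_down _ _) rfl rfl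
  · rw [riordanSum, Finset.mul_sum]
    refine Finset.sum_congr rfl fun f _ => ?_
    rw [mul_ite, mul_zero, pow_succ']
    exact if_congr (by simp [riordanFrom_level]) rfl rfl

open Real

theorem sq_add_one_add_two_mul_cos_pos {lam : ℝ} (hlam : 1 < lam) (t : ℝ) :
    0 < lam ^ 2 + 1 + 2 * lam * cos t := by
  nlinarith [neg_one_le_cos t, sq_nonneg (lam - 1), mul_pos (sub_pos.2 hlam) (sub_pos.2 hlam)]

theorem integral_sin_mul_sin_nat_mul (k : ℕ) (hk : 2 ≤ k) :
    ∫ t in (0 : ℝ)..π, sin t * sin (k * t) = 0 := by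
  have hk' : (2 : ℝ) ≤ k := by exact_mod_cast hk
  have h1 : (k : ℝ) - 1 ≠ 0 := by linarith
  have h2 : (k : ℝ) + 1 ≠ 0 := by linarith
  have hd : ∀ t ∈ Set.uIcc (0 : ℝ) π, HasDerivAt
      (fun t : ℝ => sin ((k - 1) * t) / (2 * (k - 1)) - sin ((k + 1) * t) / (2 * (k + 1)))
      (sin t * sin (k * t)) t := by
    intro t _
    have e1 := (((hasDerivAt_id t).const_mul ((k : ℝ) - 1)).sin).div_const (2 * ((k : ℝ) - 1))
    have e2 := (((hasDerivAt_id t).const_mul ((k : ℝ) + 1)).sin).div_const (2 * ((k : ℝ) + 1))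
    refine (e1.sub e2).congr_deriv ?_
    simp only [id_eq, mul_one, sub_mul, add_mul, one_mul, cos_sub, cos_add]
    field_simp
    ring
  rw [intervalIntegral.integral_eq_sub_of_hasDerivAt hd
    (Continuous.intervalIntegrable (by fun_prop) _ _)]
  have s1 : sin (((k : ℝ) - 1) * π) = 0 := by
    have := sin_int_mul_pi (k - 1); push_cast at this; exact this
  have s2 : sin (((k : ℝ) + 1) * π) = 0 := by
    have := sin_int_mul_pi (k + 1); push_cast at this; exact this
  simp [s1, s2]

/-- Chebyshev moments of the semicircle law, weighted by the Poisson kernel denominator. -/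
noncomputable def poissonSine (lam : ℝ) (k : ℕ) : ℝ :=
  ∫ t in (0 : ℝ)..π, sin t * sin (k * t) / (lam ^ 2 + 1 + 2 * lam * cos t)

theorem intervalIntegrable_poissonSine {lam : ℝ} (hlam : 1 < lam) (k : ℕ) :
    IntervalIntegrable (fun t => sin t * sin (k * t) / (lam ^ 2 + 1 + 2 * lam * cos t))
      volume 0 π := by
  have hq := fun t => (sq_add_one_add_two_mul_cos_pos hlam t).ne'
  exact Continuous.intervalIntegrable (by fun_prop (disch := exact hq)) _ _

theorem poissonSine_recurrence {lam : ℝ} (hlam : 1 < lam) (k : ℕ) :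
    (lam * poissonSine lam (k + 2) + poissonSine lam (k + 1)) +
      lam * (lam * poissonSine lam (k + 1) + poissonSine lam k) =
      ∫ t in (0 : ℝ)..π, sin t * sin ((k + 1 : ℕ) * t) := by
  have hq := fun t => (sq_add_one_add_two_mul_cos_pos hlam t).ne'
  have hi := intervalIntegrable_poissonSine hlam
  unfold poissonSine
  rw [← intervalIntegral.integral_const_mul, ← intervalIntegral.integral_const_mul,
    ← intervalIntegral.integral_add ((hi _).const_mul _) (hi _),
    ← intervalIntegral.integral_add ((hi _).const_mul _) (hi _), ← intervalIntegral.integral_const_mul,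
    ← intervalIntegral.integral_add (((hi _).const_mul _).add (hi _))
      ((((hi _).const_mul _).add (hi _)).const_mul _)]
  refine intervalIntegral.integral_congr fun t _ => ?_
  have e2 : ((k + 2 : ℕ) : ℝ) * t = (k + 1 : ℕ) * t + t := by push_cast; ring
  have e0 : (k : ℝ) * t = (k + 1 : ℕ) * t - t := by push_cast; ring
  simp only [e2, e0, sin_add, sin_sub, div_eq_mul_inv]
  linear_combination sin t * sin ((k + 1 : ℕ) * t) * mul_inv_cancel₀ (hq t)

theorem abs_poissonSine_le {lam : ℝ} (hlam : 1 < lam) (k : ℕ) :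
    |poissonSine lam k| ≤ 1 / (lam - 1) ^ 2 * π := by
  have hl : 0 < (lam - 1) ^ 2 := by have := sub_pos.2 hlam; positivity
  have := intervalIntegral.norm_integral_le_of_norm_le_const
    (a := 0) (b := π) (C := 1 / (lam - 1) ^ 2)
    (f := fun t => sin t * sin (k * t) / (lam ^ 2 + 1 + 2 * lam * cos t)) (fun t _ => by
      rw [norm_div, norm_mul, norm_eq_abs, norm_eq_abs, norm_eq_abs,
        abs_of_pos (sq_add_one_add_two_mul_cos_pos hlam t)]
      refine div_le_div₀ zero_le_one ?_ hl ?_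
      · exact mul_le_one₀ (abs_sin_le_one _) (abs_nonneg _) (abs_sin_le_one _)
      · nlinarith [neg_one_le_cos t])
  simpa [poissonSine, abs_of_pos pi_pos] using this

theorem mul_poissonSine_add_two {lam : ℝ} (hlam : 1 < lam) (k : ℕ) :
    lam * poissonSine lam (k + 2) + poissonSine lam (k + 1) = 0 := by
  set E : ℕ → ℝ := fun k => lam * poissonSine lam (k + 1) + poissonSine lam k with hE
  change E (k + 1) = 0
  have hpow : ∀ m, E (k + 1 + m) = (-lam) ^ m * E (k + 1) := by
    intro m
    induction m with
    | zero => simp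
    | succ m ih =>
      have := poissonSine_recurrence hlam (k + 1 + m)
      rw [integral_sin_mul_sin_nat_mul _ (by omega)] at this
      change E (k + 1 + m + 1) + lam * E (k + 1 + m) = 0 at this
      rw [← add_assoc, pow_succ, eq_neg_of_add_eq_zero_left this, ih]
      ring
  set C := 1 / (lam - 1) ^ 2 * π
  have hb : ∀ m, lam ^ m * |E (k + 1)| ≤ lam * C + C := by
    intro m
    have h0 : |E (k + 1 + m)| ≤ lam * C + C := by
      refine (abs_add_le _ _).trans (add_le_add ?_ (abs_poissonSine_le hlam _))
      rw [abs_mul, abs_of_pos (by linarith : 0 < lam)]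
      exact mul_le_mul_of_nonneg_left (abs_poissonSine_le hlam _) (by linarith)
    rwa [hpow, abs_mul, abs_pow, abs_neg, abs_of_pos (by linarith : 0 < lam)] at h0
  by_contra hne
  have hpos : 0 < |E (k + 1)| := abs_pos.2 hne
  obtain ⟨m, hm⟩ := pow_unbounded_of_one_lt ((lam * C + C) / |E (k + 1)|) hlam
  rw [div_lt_iff₀ hpos] at hm
  exact (hb m).not_gt hm

theorem poissonSine_zero (lam : ℝ) : poissonSine lam 0 = 0 := by
  simp [poissonSine]

theorem poissonSine_succ {lam : ℝ} (hlam : 1 < lam) (k : ℕ) :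
    poissonSine lam (k + 1) = π / (2 * lam ^ 2) * (-(1 / lam)) ^ k := by
  have hl : lam ≠ 0 := by linarith
  induction k with
  | zero =>
    have h := poissonSine_recurrence hlam 0
    have hs : ∫ t in (0 : ℝ)..π, sin t * sin ((0 + 1 : ℕ) * t) = π / 2 := by
      simp [← pow_two, integral_sin_sq]
    rw [mul_poissonSine_add_two hlam, poissonSine_zero, hs] at h
    field_simp
    linear_combination 2 * h
  | succ k ih =>
    have h := mul_poissonSine_add_two hlam k
    rw [ih] at h
    refine mul_left_cancel₀ hl (?_ : lam * poissonSine lam (k + 2) = _)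
    rw [eq_neg_of_add_eq_zero_left h]
    field_simp
    rw [pow_succ]
    field_simp

/-- Moments of the absolutely continuous part against the polynomial
`U_h + λ U_{h-1}`, after the substitution `x = λ + 2 cos t`. -/
noncomputable def trigMoment (lam : ℝ) (n h : ℕ) : ℝ :=
  ∫ t in (0 : ℝ)..π, (lam + 2 * cos t) ^ n * (2 / π *
    (sin t * (sin ((h + 1 : ℕ) * t) + lam * sin (h * t)) / (lam ^ 2 + 1 + 2 * lam * cos t)))

theorem intervalIntegrable_trigMoment {lam : ℝ} (hlam : 1 < lam) (n h : ℕ) :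
    IntervalIntegrable (fun t => (lam + 2 * cos t) ^ n * (2 / π *
      (sin t * (sin ((h + 1 : ℕ) * t) + lam * sin (h * t)) / (lam ^ 2 + 1 + 2 * lam * cos t))))
      volume 0 π := by
  have hq := fun t => (sq_add_one_add_two_mul_cos_pos hlam t).ne'
  exact Continuous.intervalIntegrable (by fun_prop (disch := exact hq)) _ _

theorem trigMoment_succ_zero (lam : ℝ) (n : ℕ) :
    trigMoment lam (n + 1) 0 = trigMoment lam n 1 := by
  refine intervalIntegral.integral_congr fun t _ => ?_
  have e : ((1 + 1 : ℕ) : ℝ) * t = 2 * t := by norm_num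
  simp only [e, sin_two_mul]
  simp
  ring

theorem trigMoment_succ_succ {lam : ℝ} (hlam : 1 < lam) (n h : ℕ) :
    trigMoment lam (n + 1) (h + 1) =
      trigMoment lam n (h + 2) + trigMoment lam n h + lam * trigMoment lam n (h + 1) := by
  have hi := intervalIntegrable_trigMoment hlam n
  unfold trigMoment
  rw [← intervalIntegral.integral_const_mul, ← intervalIntegral.integral_add (hi _) (hi _),
    ← intervalIntegral.integral_add ((hi _).add (hi _)) ((hi _).const_mul _)]
  refine intervalIntegral.integral_congr fun t _ => ?_
  have e3 : ((h + 2 + 1 : ℕ) : ℝ) * t = (h + 1 + 1 : ℕ) * t + t := by push_cast; ring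
  have e2 : ((h + 2 : ℕ) : ℝ) * t = (h + 1 : ℕ) * t + t := by push_cast; ring
  have e1 : ((h + 1 : ℕ) : ℝ) * t = (h + 1 + 1 : ℕ) * t - t := by push_cast; ring
  have e0 : (h : ℝ) * t = (h + 1 : ℕ) * t - t := by push_cast; ring
  have s1 : sin ((h + 2 + 1 : ℕ) * t) = 2 * cos t * sin ((h + 1 + 1 : ℕ) * t)
      - sin ((h + 1 : ℕ) * t) := by
    rw [e3, e1, sin_add, sin_sub]; ring
  have s0 : sin (h * t) = 2 * cos t * sin ((h + 1 : ℕ) * t) - sin ((h + 2 : ℕ) * t) := by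
    rw [e2, e0, sin_add, sin_sub]; ring
  simp only [s1, s0]
  ring

theorem trigMoment_zero {lam : ℝ} (hlam : 1 < lam) (h : ℕ) :
    trigMoment lam 0 h = 2 / π * (poissonSine lam (h + 1) + lam * poissonSine lam h) := by
  have hi := intervalIntegrable_poissonSine hlam
  unfold trigMoment poissonSine
  rw [← intervalIntegral.integral_const_mul,
    ← intervalIntegral.integral_add (hi _) ((hi _).const_mul _), ← intervalIntegral.integral_const_mul]
  refine intervalIntegral.integral_congr fun t _ => ?_
  ring

theorem atom_add_trigMoment_eq_riordanSum {lam : ℝ} (hlam : 1 < lam) (n h : ℕ) :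
    (1 - 1 / lam ^ 2) * (-(1 / lam)) ^ (n + h) + trigMoment lam n h = riordanSum lam n h := by
  have hl : lam ≠ 0 := by linarith
  have hpi := pi_ne_zero
  induction n generalizing h with
  | zero =>
    rw [riordanSum_zero, trigMoment_zero hlam]
    cases h with
    | zero =>
      rw [poissonSine_succ hlam, poissonSine_zero]
      simp
      field_simp
      ring
    | succ h =>
      rw [poissonSine_succ hlam, poissonSine_succ hlam]
      simp only [zero_add, pow_succ, Nat.add_eq_zero_iff, one_ne_zero, and_false, if_false]
      field_simp
      ring
  | succ n ih =>
    cases h with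
    | zero => rw [riordanSum_succ_zero, trigMoment_succ_zero, ← ih]
    | succ h =>
      rw [riordanSum_succ_succ, trigMoment_succ_succ hlam, ← ih, ← ih, ← ih]
      rw [show n + 1 + (h + 1) = n + h + 2 by ring, show n + (h + 2) = n + h + 2 by ring,
        show n + (h + 1) = n + h + 1 by ring]
      simp only [pow_succ]
      field_simp
      ring

theorem integral_semicircle_eq_trigMoment {lam : ℝ} (hlam : 1 < lam) (n : ℕ) :
    (∫ x in (lam - 2)..(lam + 2),
        x ^ n * (√(4 - (x - lam) ^ 2) / (2 * π * (lam * x + 1)))) = trigMoment lam n 0 := by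
  have hd : ∀ t ∈ Set.uIcc π 0, HasDerivAt (fun t => lam + 2 * cos t) (-(2 * sin t)) t := by
    intro t _
    simpa using ((hasDerivAt_cos t).const_mul 2).const_add lam
  have hsub := intervalIntegral.integral_comp_mul_deriv' (f := fun t => lam + 2 * cos t)
    (g := fun x => x ^ n * (√(4 - (x - lam) ^ 2) / (2 * π * (lam * x + 1)))) hd
    (by fun_prop) (by
      have hq : ∀ x ∈ (fun t => lam + 2 * cos t) '' Set.uIcc π 0,
          2 * π * (lam * x + 1) ≠ 0 := by
        rintro _ ⟨t, -, rfl⟩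
        have := sq_add_one_add_two_mul_cos_pos hlam t
        have : 0 < lam * (lam + 2 * cos t) + 1 := by linarith
        have := pi_pos
        positivity
      fun_prop (disch := assumption))
  simp only [cos_pi, cos_zero] at hsub
  rw [show lam - 2 = lam + 2 * -1 by ring, show lam + 2 = lam + 2 * 1 by ring, ← hsub,
    intervalIntegral.integral_symm, ← intervalIntegral.integral_neg]
  refine intervalIntegral.integral_congr fun t ht => ?_
  rw [Set.uIcc_of_le pi_pos.le] at ht
  have hs := sin_nonneg_of_nonneg_of_le_pi ht.1 ht.2
  have hsqrt : √(4 - (lam + 2 * cos t - lam) ^ 2) = 2 * sin t := by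
    rw [show 4 - (lam + 2 * cos t - lam) ^ 2 = (2 * sin t) ^ 2 by
      nlinarith [sin_sq_add_cos_sq t], sqrt_sq (by linarith)]
  have hq := (sq_add_one_add_two_mul_cos_pos hlam t).ne'
  have hpi := pi_ne_zero
  simp only [Function.comp, hsqrt]
  rw [show lam * (lam + 2 * cos t) + 1 = lam ^ 2 + 1 + 2 * lam * cos t by ring]
  simp
  field_simp

theorem stmt1 (lam : ℝ) (hlam : 1 < lam) (n : ℕ) :
    (1 - 1 / lam ^ 2) * (-(1 / lam)) ^ n +
      (∫ x in (lam - 2)..(lam + 2),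
        x ^ n * (Real.sqrt (4 - (x - lam) ^ 2) / (2 * Real.pi * (lam * x + 1))))
      = bOne lam n := by
  rw [integral_semicircle_eq_trigMoment hlam, bOne_eq_riordanSum]
  exact atom_add_trigMoment_eq_riordanSum hlam n 0
end

section
/- For every λ > 0 and every real z with 0 < z < 1/(λ + 2), the generating series of the λ-weighted Riordan counts converges and satisfies Σ_{n=0}^∞ b_{1,n}(λ) z^n = ((1 + λz) − √((1 − λz)² − 4z²)) / (2(λz + z²)), where √ is the real square root. -/
open MeasureTheory

/-- Words that, started at height `h`, stay nonnegative, end at height `0` and have no level-step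
at height `0`. -/
def IsRiordanFrom (h : ℕ) (u : List (Fin 3)) : Prop :=
  (∀ j : ℕ, (u.take j).count 1 ≤ (u.take j).count 0 + h) ∧ u.count 0 + h = u.count 1 ∧
    ∀ j : ℕ, u[j]? = some 2 → (u.take j).count 1 < (u.take j).count 0 + h

theorem isRiordan_iff_isRiordanFrom_zero (u : List (Fin 3)) :
    IsRiordan u ↔ IsRiordanFrom 0 u := by
  unfold IsRiordan IsMotzkin IsRiordanFrom
  simp only [add_zero, and_assoc]
  refine and_congr_right fun _ => and_congr_right fun _ => ⟨fun H j hj => ?_, fun H j hj => ?_⟩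
  · obtain ⟨hlt, hj⟩ := List.getElem?_eq_some_iff.1 hj
    exact H ⟨j, hlt⟩ hj
  · exact H j (List.getElem?_eq_some_iff.2 ⟨j.2, hj⟩)

theorem forall_nat_iff_zero_and_succ {p : ℕ → Prop} :
    (∀ j, p j) ↔ p 0 ∧ ∀ j, p (j + 1) :=
  ⟨fun H => ⟨H 0, fun j => H (j + 1)⟩, fun H j => by cases j with
    | zero => exact H.1
    | succ j => exact H.2 j⟩

theorem isRiordanFrom_nil (h : ℕ) : IsRiordanFrom h [] ↔ h = 0 := by
  simp [IsRiordanFrom]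

theorem isRiordanFrom_up (h : ℕ) (u : List (Fin 3)) :
    IsRiordanFrom h (0 :: u) ↔ IsRiordanFrom (h + 1) u := by
  unfold IsRiordanFrom
  rw [forall_nat_iff_zero_and_succ,
    forall_nat_iff_zero_and_succ (p := fun j => (0 :: u)[j]? = some 2 → _)]
  simp [add_assoc, add_comm 1 h]

theorem not_isRiordanFrom_zero_down (u : List (Fin 3)) : ¬ IsRiordanFrom 0 (1 :: u) := by
  intro H
  simpa using H.1 1

theorem isRiordanFrom_succ_down (h : ℕ) (u : List (Fin 3)) :
    IsRiordanFrom (h + 1) (1 :: u) ↔ IsRiordanFrom h u := by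
  unfold IsRiordanFrom
  rw [forall_nat_iff_zero_and_succ,
    forall_nat_iff_zero_and_succ (p := fun j => (1 :: u)[j]? = some 2 → _)]
  simp [← add_assoc]

theorem not_isRiordanFrom_zero_level (u : List (Fin 3)) : ¬ IsRiordanFrom 0 (2 :: u) := by
  intro H
  simpa using H.2.2 0

theorem isRiordanFrom_succ_level (h : ℕ) (u : List (Fin 3)) :
    IsRiordanFrom (h + 1) (2 :: u) ↔ IsRiordanFrom (h + 1) u := by
  unfold IsRiordanFrom
  rw [forall_nat_iff_zero_and_succ,
    forall_nat_iff_zero_and_succ (p := fun j => (2 :: u)[j]? = some 2 → _)]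
  simp

/-- The weighted count of Riordan words of a given size from a given height, by its first-step
recursion. -/
def riordanWeight (lam : ℝ) : ℕ → ℕ → ℝ
  | 0, 0 => 1
  | 0, _ + 1 => 0
  | n + 1, 0 => riordanWeight lam n 1
  | n + 1, h + 1 =>
    riordanWeight lam n (h + 2) + riordanWeight lam n h + lam * riordanWeight lam n (h + 1)

theorem sum_fin_succ_three {M : Type*} [AddCommMonoid M] (n : ℕ) (F : (Fin (n + 1) → Fin 3) → M) :
    ∑ f, F f = ∑ f : Fin n → Fin 3, F (Fin.cons 0 f) + ∑ f : Fin n → Fin 3, F (Fin.cons 1 f) +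
      ∑ f : Fin n → Fin 3, F (Fin.cons 2 f) := by
  rw [← (Fin.consEquiv fun _ : Fin (n + 1) => Fin 3).sum_comp, Fintype.sum_prod_type,
    Fin.sum_univ_three]
  rfl

open Classical in
theorem sum_isRiordanFrom_eq_riordanWeight (lam : ℝ) (n h : ℕ) :
    (∑ f : Fin n → Fin 3,
      if IsRiordanFrom h (List.ofFn f) then lam ^ ((List.ofFn f).count 2) else 0) =
      riordanWeight lam n h := by
  induction n generalizing h with
  | zero => cases h <;> simp [isRiordanFrom_nil, riordanWeight]
  | succ n ih =>
    rw [sum_fin_succ_three]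
    simp only [List.ofFn_cons]
    cases h with
    | zero =>
      simp [isRiordanFrom_up, not_isRiordanFrom_zero_down, not_isRiordanFrom_zero_level,
        riordanWeight, ih]
    | succ h =>
      simp only [isRiordanFrom_up, isRiordanFrom_succ_down, isRiordanFrom_succ_level,
        riordanWeight, ← ih, Finset.mul_sum]
      simp [pow_succ']

open Classical in
theorem bOne_eq_riordanWeight (lam : ℝ) (n : ℕ) : bOne lam n = riordanWeight lam n 0 := by
  rw [← sum_isRiordanFrom_eq_riordanWeight]
  exact Finset.sum_congr rfl fun f _ => if_congr (isRiordan_iff_isRiordanFrom_zero _) rfl rfl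

theorem riordanWeight_nonneg {lam : ℝ} (hlam : 0 ≤ lam) (n h : ℕ) :
    0 ≤ riordanWeight lam n h := by
  induction n generalizing h with
  | zero => cases h <;> simp [riordanWeight]
  | succ n ih =>
    cases h with
    | zero => exact ih 1
    | succ h =>
      have h₁ := ih (h + 2)
      have h₂ := ih h
      have h₃ := ih (h + 1)
      simp only [riordanWeight]
      positivity

theorem riordanWeight_le {lam : ℝ} (hlam : 0 ≤ lam) (n h : ℕ) :
    riordanWeight lam n h ≤ (lam + 2) ^ n := by
  induction n generalizing h with
  | zero => cases h <;> simp [riordanWeight]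
  | succ n ih =>
    have hp : 0 ≤ (lam + 2) ^ n := by positivity
    rw [pow_succ]
    cases h with
    | zero =>
      simp only [riordanWeight]
      nlinarith [ih 1, mul_nonneg hp hlam]
    | succ h =>
      simp only [riordanWeight]
      nlinarith [ih (h + 2), ih h, mul_le_mul_of_nonneg_left (ih (h + 1)) hlam]

/-- A bounded solution of `z W (h + 2) - (1 - lam z) W (h + 1) + z W h = 0` is geometric, with
ratio the root in `(0, 1)` of the characteristic equation. -/
theorem eq_mul_of_bounded_recurrence {W : ℕ → ℝ} {C c z r : ℝ} (hz : 0 < z) (hr0 : 0 < r)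
    (hr1 : r < 1) (hr : z * r ^ 2 + z = c * r) (hW0 : ∀ h, 0 ≤ W h) (hWC : ∀ h, W h ≤ C)
    (hrec : ∀ h, z * W (h + 2) + z * W h = c * W (h + 1)) : W 1 = r * W 0 := by
  have step : ∀ h, W (h + 1) - r * W h = r * (W (h + 2) - r * W (h + 1)) := by
    intro h
    apply mul_left_cancel₀ hz.ne'
    linear_combination (-r) * hrec h + W (h + 1) * hr
  have geom : ∀ h, W 1 - r * W 0 = r ^ h * (W (h + 1) - r * W h) := by
    intro h
    induction h with
    | zero => simp
    | succ h ih => rw [ih, step h]; ring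
  have bound : ∀ h, |W 1 - r * W 0| ≤ r ^ h * C := by
    intro h
    rw [geom h, abs_mul, abs_of_nonneg (pow_nonneg hr0.le h)]
    refine mul_le_mul_of_nonneg_left (abs_le.2 ⟨?_, ?_⟩) (pow_nonneg hr0.le h)
    · nlinarith [hW0 (h + 1), hWC h, hW0 h]
    · nlinarith [hWC (h + 1), mul_nonneg hr0.le (hW0 h)]
  have lim : Filter.Tendsto (fun h : ℕ => r ^ h * C) Filter.atTop (nhds 0) := by
    simpa using (tendsto_pow_atTop_nhds_zero_of_lt_one hr0.le hr1).mul_const C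
  have := ge_of_tendsto' lim bound
  exact sub_eq_zero.1 (abs_nonpos_iff.1 this)

theorem stmt4 (lam : ℝ) (hlam : 0 < lam) (z : ℝ) (hz0 : 0 < z)
    (hz1 : z < 1 / (lam + 2)) :
    HasSum (fun n : ℕ => bOne lam n * z ^ n)
      (((1 + lam * z) - Real.sqrt ((1 - lam * z) ^ 2 - 4 * z ^ 2)) /
        (2 * (lam * z + z ^ 2))) := by
  have hq : (lam + 2) * z < 1 := by
    rw [lt_div_iff₀ (by positivity)] at hz1
    linarith
  have hq0 : 0 ≤ (lam + 2) * z := by positivity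
  have hnonneg : ∀ h n, 0 ≤ riordanWeight lam n h * z ^ n := fun h n =>
    mul_nonneg (riordanWeight_nonneg hlam.le n h) (by positivity)
  have hle : ∀ h n, riordanWeight lam n h * z ^ n ≤ ((lam + 2) * z) ^ n := fun h n => by
    rw [mul_pow]
    exact mul_le_mul_of_nonneg_right (riordanWeight_le hlam.le n h) (by positivity)
  have hgeom := summable_geometric_of_lt_one hq0 hq
  have hsum : ∀ h, Summable fun n => riordanWeight lam n h * z ^ n := fun h =>
    Summable.of_nonneg_of_le (hnonneg h) (hle h) hgeom
  set W : ℕ → ℝ := fun h => ∑' n, riordanWeight lam n h * z ^ n with hW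
  have hW0 : W 0 = 1 + z * W 1 := by
    simp only [hW]
    rw [(hsum 0).tsum_eq_zero_add, ← tsum_mul_left]
    congr 1
    · simp [riordanWeight]
    · exact tsum_congr fun n => by simp only [riordanWeight]; ring
  have hWrec : ∀ h, z * W (h + 2) + z * W h = (1 - lam * z) * W (h + 1) := by
    intro h
    have key : W (h + 1) = z * W (h + 2) + z * W h + lam * z * W (h + 1) := by
      have hs := (((hsum (h + 2)).hasSum.mul_left z).add ((hsum h).hasSum.mul_left z)).add
        ((hsum (h + 1)).hasSum.mul_left (lam * z))
      rw [← hs.tsum_eq]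
      simp only [hW]
      rw [(hsum (h + 1)).tsum_eq_zero_add]
      simp only [riordanWeight, zero_mul, zero_add]
      exact tsum_congr fun n => by ring
    linarith
  set s := Real.sqrt ((1 - lam * z) ^ 2 - 4 * z ^ 2) with hs
  have hlz : 0 < lam * z := by positivity
  have hd : 0 < (1 - lam * z) ^ 2 - 4 * z ^ 2 := by nlinarith
  have hs0 : 0 < s := Real.sqrt_pos.2 hd
  have hs2 : s ^ 2 = (1 - lam * z) ^ 2 - 4 * z ^ 2 := Real.sq_sqrt hd.le
  have hslt : s < 1 - lam * z := by nlinarith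
  have hsgt : 1 - lam * z - 2 * z < s := by nlinarith
  have hW1 : W 1 = (1 - lam * z - s) / (2 * z) * W 0 := by
    refine eq_mul_of_bounded_recurrence (C := ∑' n, ((lam + 2) * z) ^ n) hz0
      (div_pos (by linarith) (by positivity)) ?_ ?_ (fun h => tsum_nonneg (hnonneg h))
      (fun h => (hsum h).tsum_le_tsum (hle h) hgeom) hWrec
    · rw [div_lt_one (by positivity)]
      linarith
    · field_simp
      linear_combination hs2
  have hval : W 0 = ((1 + lam * z) - s) / (2 * (lam * z + z ^ 2)) := by
    have h1 : W 0 * (1 + lam * z + s) = 2 := by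
      rw [hW1] at hW0
      field_simp at hW0
      linear_combination hW0
    rw [eq_div_iff (by positivity)]
    apply mul_right_cancel₀ (show 1 + lam * z + s ≠ 0 by positivity)
    linear_combination (2 * (lam * z + z ^ 2)) * h1 + hs2
  rw [← hval]
  simp only [bOne_eq_riordanWeight]
  exact (hsum 0).hasSum
end

section
/- For every λ > 0 and every natural number n, the n-th moment of the shifted semicircle distribution equals the λ-weighted Motzkin count: ∫_{λ−2}^{λ+2} x^n · (1/(2π))·√(4 − (x − λ)²) dx = M_n(λ). -/
open MeasureTheory

/-- Words that stay at nonnegative height and end at height `0` when started at height `h`. -/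
def IsMotzkinFrom (h : ℕ) (u : List (Fin 3)) : Prop :=
  (∀ j : ℕ, (u.take j).count 1 ≤ h + (u.take j).count 0) ∧ h + u.count 0 = u.count 1

theorem isMotzkinFrom_zero (u : List (Fin 3)) : IsMotzkinFrom 0 u ↔ IsMotzkin u := by
  simp [IsMotzkinFrom, IsMotzkin]

theorem isMotzkinFrom_nil (h : ℕ) : IsMotzkinFrom h [] ↔ h = 0 := by
  simp [IsMotzkinFrom]

theorem isMotzkinFrom_cons (h : ℕ) (s : Fin 3) (u : List (Fin 3)) :
    IsMotzkinFrom h (s :: u) ↔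
      (∀ j : ℕ, (s :: u.take j).count 1 ≤ h + (s :: u.take j).count 0) ∧
        h + (s :: u).count 0 = (s :: u).count 1 := by
  refine and_congr_left fun _ => ⟨fun H j => H (j + 1), fun H j => ?_⟩
  cases j with
  | zero => simp
  | succ j => exact H j

theorem isMotzkinFrom_up (h : ℕ) (u : List (Fin 3)) :
    IsMotzkinFrom h (0 :: u) ↔ IsMotzkinFrom (h + 1) u := by
  rw [isMotzkinFrom_cons]
  simp [IsMotzkinFrom, add_assoc, add_comm]

theorem isMotzkinFrom_zero_down (u : List (Fin 3)) : ¬ IsMotzkinFrom 0 (1 :: u) := by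
  rw [isMotzkinFrom_cons]
  rintro ⟨H, -⟩
  simpa using H 0

theorem isMotzkinFrom_succ_down (h : ℕ) (u : List (Fin 3)) :
    IsMotzkinFrom (h + 1) (1 :: u) ↔ IsMotzkinFrom h u := by
  rw [isMotzkinFrom_cons]
  simp only [IsMotzkinFrom, List.count_cons_self, ne_eq, one_ne_zero, not_false_eq_true,
    List.count_cons_of_ne]
  refine and_congr (forall_congr' fun j => ?_) ?_ <;> omega

theorem isMotzkinFrom_level (h : ℕ) (u : List (Fin 3)) :
    IsMotzkinFrom h (2 :: u) ↔ IsMotzkinFrom h u := by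
  rw [isMotzkinFrom_cons]
  simp [IsMotzkinFrom]

open Classical in
/-- The `lam`-weighted count of words of length `n` leading from height `h` to height `0`. -/
noncomputable def motzkinWeight (lam : ℝ) (n h : ℕ) : ℝ :=
  ∑ f : Fin n → Fin 3,
    if IsMotzkinFrom h (List.ofFn f) then lam ^ ((List.ofFn f).count 2) else 0

open Classical in
theorem motzkinWeight_zero_right (lam : ℝ) (n : ℕ) : motzkinWeight lam n 0 = mOne lam n := by
  simp [motzkinWeight, mOne, isMotzkinFrom_zero]

theorem motzkinWeight_zero_left (lam : ℝ) (h : ℕ) :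
    motzkinWeight lam 0 h = if h = 0 then 1 else 0 := by
  simp [motzkinWeight, isMotzkinFrom_nil]

open Classical in
theorem motzkinWeight_succ_left (lam : ℝ) (n h : ℕ) :
    motzkinWeight lam (n + 1) h =
      ∑ s : Fin 3, ∑ f : Fin n → Fin 3,
        if IsMotzkinFrom h (s :: List.ofFn f) then lam ^ ((s :: List.ofFn f).count 2) else 0 := by
  rw [motzkinWeight, ← Fintype.sum_prod_type',
    ← (Fin.consEquiv fun _ : Fin (n + 1) => Fin 3).sum_comp]
  simp [Fin.consEquiv, List.ofFn_succ]

open Classical in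
theorem motzkinWeight_succ_zero (lam : ℝ) (n : ℕ) :
    motzkinWeight lam (n + 1) 0 = lam * motzkinWeight lam n 0 + motzkinWeight lam n 1 := by
  rw [motzkinWeight_succ_left]
  simp [Fin.sum_univ_three, isMotzkinFrom_up, isMotzkinFrom_zero_down, isMotzkinFrom_level,
    List.count_cons, motzkinWeight, Finset.mul_sum, pow_succ']
  ring

open Classical in
theorem motzkinWeight_succ_succ (lam : ℝ) (n h : ℕ) :
    motzkinWeight lam (n + 1) (h + 1) =
      lam * motzkinWeight lam n (h + 1) + motzkinWeight lam n (h + 2) + motzkinWeight lam n h := by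
  rw [motzkinWeight_succ_left]
  simp [Fin.sum_univ_three, isMotzkinFrom_up, isMotzkinFrom_succ_down, isMotzkinFrom_level,
    List.count_cons, motzkinWeight, Finset.mul_sum, pow_succ']
  ring

/-- The sine moments of the semicircle density shifted by `lam`, in the angular variable. -/
noncomputable def sineMoment (lam : ℝ) (n k : ℕ) : ℝ :=
  2 / Real.pi * ∫ θ in (0 : ℝ)..Real.pi,
    (lam + 2 * Real.cos θ) ^ n * (Real.sin (k * θ) * Real.sin θ)

theorem sineMoment_zero_right (lam : ℝ) (n : ℕ) : sineMoment lam n 0 = 0 := by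
  simp [sineMoment]

theorem integral_cos_nat_mul (m : ℕ) :
    ∫ θ in (0 : ℝ)..Real.pi, Real.cos (m * θ) = if m = 0 then Real.pi else 0 := by
  split_ifs with hm
  · simp [hm]
  · rw [intervalIntegral.integral_comp_mul_left _ (Nat.cast_ne_zero.2 hm)]
    simp [Real.sin_nat_mul_pi]

theorem sineMoment_zero_left (lam : ℝ) (h : ℕ) :
    sineMoment lam 0 (h + 1) = if h = 0 then 1 else 0 := by
  have key (θ : ℝ) : (lam + 2 * Real.cos θ) ^ 0 * (Real.sin ((h + 1 : ℕ) * θ) * Real.sin θ) =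
      (1 / 2) * (Real.cos (h * θ) - Real.cos ((h + 2 : ℕ) * θ)) := by
    have h₁ : (h : ℝ) * θ = (h + 1 : ℕ) * θ - θ := by push_cast; ring
    have h₂ : ((h + 2 : ℕ) : ℝ) * θ = (h + 1 : ℕ) * θ + θ := by push_cast; ring
    rw [h₁, h₂, Real.cos_sub, Real.cos_add]
    ring
  simp only [sineMoment, key]
  rw [intervalIntegral.integral_const_mul, intervalIntegral.integral_sub
    (Continuous.intervalIntegrable (by fun_prop) _ _)
    (Continuous.intervalIntegrable (by fun_prop) _ _), integral_cos_nat_mul, integral_cos_nat_mul]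
  have := Real.pi_ne_zero
  rw [if_neg (show h + 2 ≠ 0 by omega)]
  split_ifs
  · field_simp
    ring
  · ring

theorem sineMoment_succ (lam : ℝ) (n k : ℕ) :
    sineMoment lam (n + 1) (k + 1) =
      lam * sineMoment lam n (k + 1) + sineMoment lam n (k + 2) + sineMoment lam n k := by
  have key (θ : ℝ) :
      (lam + 2 * Real.cos θ) ^ (n + 1) * (Real.sin ((k + 1 : ℕ) * θ) * Real.sin θ) =
      lam * ((lam + 2 * Real.cos θ) ^ n * (Real.sin ((k + 1 : ℕ) * θ) * Real.sin θ)) +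
        (lam + 2 * Real.cos θ) ^ n * (Real.sin ((k + 2 : ℕ) * θ) * Real.sin θ) +
        (lam + 2 * Real.cos θ) ^ n * (Real.sin (k * θ) * Real.sin θ) := by
    have h₁ : (k : ℝ) * θ = (k + 1 : ℕ) * θ - θ := by push_cast; ring
    have h₂ : ((k + 2 : ℕ) : ℝ) * θ = (k + 1 : ℕ) * θ + θ := by push_cast; ring
    rw [h₁, h₂, Real.sin_sub, Real.sin_add]
    ring
  simp only [sineMoment, key]
  rw [intervalIntegral.integral_add (Continuous.intervalIntegrable (by fun_prop) _ _)
      (Continuous.intervalIntegrable (by fun_prop) _ _),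
    intervalIntegral.integral_add (Continuous.intervalIntegrable (by fun_prop) _ _)
      (Continuous.intervalIntegrable (by fun_prop) _ _), intervalIntegral.integral_const_mul]
  ring

theorem sineMoment_eq_motzkinWeight (lam : ℝ) (n h : ℕ) :
    sineMoment lam n (h + 1) = motzkinWeight lam n h := by
  induction n generalizing h with
  | zero => rw [sineMoment_zero_left, motzkinWeight_zero_left]
  | succ n ih =>
    cases h with
    | zero => rw [sineMoment_succ, sineMoment_zero_right, motzkinWeight_succ_zero, ih, ih, add_zero]
    | succ h => rw [sineMoment_succ, motzkinWeight_succ_succ, ih, ih, ih]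

theorem integral_semicircle_eq_sineMoment (lam : ℝ) (n : ℕ) :
    (∫ x in (lam - 2)..(lam + 2),
        x ^ n * (1 / (2 * Real.pi) * Real.sqrt (4 - (x - lam) ^ 2)))
      = sineMoment lam n 1 := by
  have hderiv (θ : ℝ) : HasDerivAt (fun θ => lam + 2 * Real.cos θ) (-(2 * Real.sin θ)) θ := by
    simpa using ((Real.hasDerivAt_cos θ).const_mul 2).const_add lam
  have hsub := intervalIntegral.integral_comp_mul_deriv (a := 0) (b := Real.pi)
    (g := fun x => x ^ n * (1 / (2 * Real.pi) * Real.sqrt (4 - (x - lam) ^ 2)))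
    (fun θ _ => hderiv θ) (by fun_prop) (by fun_prop)
  simp only [Real.cos_zero, Real.cos_pi, mul_one, mul_neg, ← sub_eq_add_neg] at hsub
  rw [intervalIntegral.integral_symm, ← hsub, sineMoment, ← intervalIntegral.integral_neg,
    ← intervalIntegral.integral_const_mul]
  refine intervalIntegral.integral_congr fun θ hθ => ?_
  rw [Set.uIcc_of_le Real.pi_pos.le] at hθ
  have hsqrt : Real.sqrt (4 - (lam + 2 * Real.cos θ - lam) ^ 2) = 2 * Real.sin θ := by
    rw [← Real.sqrt_sq (mul_nonneg zero_le_two (Real.sin_nonneg_of_mem_Icc hθ))]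
    congr 1
    linear_combination (-4) * Real.sin_sq_add_cos_sq θ
  simp only [Function.comp_apply, hsqrt, Nat.cast_one, one_mul]
  have := Real.pi_ne_zero
  field_simp

theorem stmt8 (lam : ℝ) (hlam : 0 < lam) (n : ℕ) :
    (∫ x in (lam - 2)..(lam + 2),
        x ^ n * (1 / (2 * Real.pi) * Real.sqrt (4 - (x - lam) ^ 2)))
      = mOne lam n := by
  rw [integral_semicircle_eq_sineMoment, sineMoment_eq_motzkinWeight, motzkinWeight_zero_right]
end
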